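/- arXiv:1710.02981 — 2 statements merged into one kernel-verified Lean document; each statement's English description precedes it below -/
import Mathlib

section
/- Let α > 0 and 1 < p < ∞. There exists a bounded linear operator T on ℓ^p(ℕ) such that T is topologically mixing and T is (C,α)-mean ergodic. -/
open Filter
open scoped ENNReal

/-- The Cesàro kernel of order `α`: `k^α(n) = Γ(α+n) / (Γ(α)·Γ(n+1))`. -/
noncomputable def cesKernel (α : ℝ) (n : ℕ) : ℝ :=
  Real.Gamma (α + n) / (Real.Gamma α * Real.Gamma (n + 1))

/-- A bounded linear operator `T` on a complex Banach space is absolutely `(C,α)`-Cesàro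
bounded if there is `C > 0` with
`(1/k^{α+1}(n)) · Σ_{j=0}^n k^α(n-j) ‖T^j x‖ ≤ C ‖x‖` for all `n` and `x`. -/
def AbsCesaroBounded {X : Type*} [NormedAddCommGroup X] [NormedSpace ℂ X]
    (α : ℝ) (T : X →L[ℂ] X) : Prop :=
  ∃ C : ℝ, 0 < C ∧ ∀ (n : ℕ) (x : X),
    (cesKernel (α + 1) n)⁻¹ *
      ∑ j ∈ Finset.range (n + 1), cesKernel α (n - j) * ‖(T ^ j) x‖ ≤ C * ‖x‖

/-- The Cesàro mean of order `α` of `T`: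
`M_T^α(n) = (1/k^{α+1}(n)) · Σ_{j=0}^n k^α(n-j) T^j`. -/
noncomputable def cesMean {X : Type*} [NormedAddCommGroup X] [NormedSpace ℂ X]
    (α : ℝ) (T : X →L[ℂ] X) (n : ℕ) : X →L[ℂ] X :=
  (((cesKernel (α + 1) n)⁻¹ : ℝ) : ℂ) •
    ∑ j ∈ Finset.range (n + 1), ((cesKernel α (n - j) : ℝ) : ℂ) • T ^ j

/-- `T` is topologically mixing if for all non-empty open sets `U, V` there is `n₀` with
`T^n(U) ∩ V ≠ ∅` for all `n ≥ n₀`. -/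
def TopologicallyMixing {X : Type*} [NormedAddCommGroup X] [NormedSpace ℂ X]
    (T : X →L[ℂ] X) : Prop :=
  ∀ U V : Set X, IsOpen U → IsOpen V → U.Nonempty → V.Nonempty →
    ∃ n₀ : ℕ, ∀ n : ℕ, n ≥ n₀ → ((⇑(T ^ n)) '' U ∩ V).Nonempty

lemma cesKernel_pos {α : ℝ} (hα : 0 < α) (n : ℕ) : 0 < cesKernel α n := by
  unfold cesKernel
  have h1 : 0 < Real.Gamma (α + n) := Real.Gamma_pos_of_pos (by positivity)
  have h2 : 0 < Real.Gamma α := Real.Gamma_pos_of_pos hα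
  have h3 : 0 < Real.Gamma ((n : ℝ) + 1) := Real.Gamma_pos_of_pos (by positivity)
  positivity

lemma cesKernel_eq {α : ℝ} (hα : 0 < α) (n : ℕ) :
    cesKernel α n = cesKernel (α + 1) n * (α / (α + n)) := by
  unfold cesKernel
  have h2 : 0 < Real.Gamma α := Real.Gamma_pos_of_pos hα
  have h3 : 0 < Real.Gamma ((n : ℝ) + 1) := Real.Gamma_pos_of_pos (by positivity)
  have h4 : (α + n : ℝ) ≠ 0 := by positivity
  rw [show α + 1 + (n : ℝ) = (α + n) + 1 by ring, Real.Gamma_add_one h4, Real.Gamma_add_one hα.ne']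
  field_simp

lemma cesKernel_succ {α : ℝ} (hα : 0 < α) (n : ℕ) :
    cesKernel (α + 1) (n + 1) = cesKernel (α + 1) n * ((α + n + 1) / (n + 1)) := by
  unfold cesKernel
  have h2 : 0 < Real.Gamma (α + 1) := Real.Gamma_pos_of_pos (by positivity)
  have h3 : 0 < Real.Gamma ((n : ℝ) + 1) := Real.Gamma_pos_of_pos (by positivity)
  have h4 : (α + n + 1 : ℝ) ≠ 0 := by positivity
  have h5 : (n + 1 : ℝ) ≠ 0 := by positivity
  push_cast
  rw [show α + 1 + ((n : ℝ) + 1) = (α + n + 1) + 1 by ring, Real.Gamma_add_one h4,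
    Real.Gamma_add_one h5, show α + 1 + (n : ℝ) = α + n + 1 by ring]
  field_simp

lemma cesKernel_sum {α : ℝ} (hα : 0 < α) (n : ℕ) :
    ∑ j ∈ Finset.range (n + 1), cesKernel α (n - j) = cesKernel (α + 1) n := by
  have h := Finset.sum_range_reflect (fun i => cesKernel α i) (n + 1)
  simp only [Nat.add_sub_cancel] at h
  have h' : ∑ j ∈ Finset.range (n + 1), cesKernel α (n - j)
      = ∑ j ∈ Finset.range (n + 1), cesKernel α j := by
    rw [← h]
  rw [h']
  clear h h'
  induction n with
  | zero =>
    rw [Finset.sum_range_one, cesKernel_eq hα]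
    simp [hα.ne']
  | succ n ih =>
    rw [Finset.sum_range_succ, ih, cesKernel_eq hα, cesKernel_succ hα]
    have h4 : (α + n + 1 : ℝ) ≠ 0 := by positivity
    have h5 : (n + 1 : ℝ) ≠ 0 := by positivity
    push_cast
    rw [show α + ((n : ℝ) + 1) = α + n + 1 by ring]
    field_simp
    ring

lemma gamma_prod {α : ℝ} (hα : 0 < α) (n : ℕ) :
    Real.Gamma (α + n) = Real.Gamma α * ∏ j ∈ Finset.range n, (α + j) := by
  induction n with
  | zero => simp
  | succ n ih =>
    have h4 : (α + n : ℝ) ≠ 0 := by positivity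
    rw [Finset.prod_range_succ, Nat.cast_succ, ← add_assoc, Real.Gamma_add_one h4, ih]
    ring

lemma cesKernel_ratio {α : ℝ} (hα : 0 < α) :
    Tendsto (fun n : ℕ => cesKernel (α + 1) n / ((n : ℝ) + 1) ^ α) atTop
      (nhds (Real.Gamma (α + 1))⁻¹) := by
  have hG : 0 < Real.Gamma α := Real.Gamma_pos_of_pos hα
  have hG1 : 0 < Real.Gamma (α + 1) := Real.Gamma_pos_of_pos (by positivity)
  have h1 : Tendsto (fun n : ℕ => ((n : ℝ) / ((n : ℝ) + 1)) ^ α) atTop (nhds 1) := by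
    have := (tendsto_natCast_div_add_atTop (1 : ℝ)).rpow_const (p := α) (Or.inr hα.le)
    simpa using this
  have h2 := (Real.GammaSeq_tendsto_Gamma α).inv₀ hG.ne'
  have h3 := ((h2.mul h1).const_mul (Real.Gamma α / Real.Gamma (α + 1)))
  have e : Real.Gamma α / Real.Gamma (α + 1) * ((Real.Gamma α)⁻¹ * 1)
      = (Real.Gamma (α + 1))⁻¹ := by field_simp
  rw [e] at h3
  refine h3.congr' ?_
  filter_upwards [eventually_gt_atTop 0] with n hn
  have hn' : (0 : ℝ) < n := by exact_mod_cast hn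
  unfold cesKernel Real.GammaSeq
  have h5 : 0 < ∏ j ∈ Finset.range (n + 1), (α + (j : ℝ)) :=
    Finset.prod_pos (fun j _ => by positivity)
  rw [Real.div_rpow hn'.le (by positivity), Real.Gamma_nat_eq_factorial,
    show α + 1 + (n : ℝ) = α + ((n + 1 : ℕ) : ℝ) by push_cast; ring, gamma_prod hα]
  have h6 : 0 < (n : ℝ) ^ α := by positivity
  have h7 : 0 < ((n : ℝ) + 1) ^ α := by positivity
  have h8 : (0 : ℝ) < (Nat.factorial n : ℝ) := by positivity
  field_simp

lemma cesKernel_bounds {α : ℝ} (hα : 0 < α) :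
    ∃ c C : ℝ, 0 < c ∧ 0 < C ∧ ∀ n : ℕ, c * ((n : ℝ) + 1) ^ α ≤ cesKernel (α + 1) n ∧
      cesKernel (α + 1) n ≤ C * ((n : ℝ) + 1) ^ α := by
  have hG1 : 0 < Real.Gamma (α + 1) := Real.Gamma_pos_of_pos (by positivity)
  have h := cesKernel_ratio hα
  obtain ⟨C, hC⟩ := h.bddAbove_range
  obtain ⟨D, hD⟩ := (h.inv₀ (by positivity)).bddAbove_range
  have hpos : ∀ n : ℕ, 0 < cesKernel (α + 1) n / ((n : ℝ) + 1) ^ α := fun n =>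
    div_pos (cesKernel_pos (by positivity) n) (by positivity)
  have hC' : ∀ n : ℕ, cesKernel (α + 1) n / ((n : ℝ) + 1) ^ α ≤ C := fun n => hC ⟨n, rfl⟩
  have hD' : ∀ n : ℕ, (cesKernel (α + 1) n / ((n : ℝ) + 1) ^ α)⁻¹ ≤ D := fun n => hD ⟨n, rfl⟩
  have hDpos : 0 < D := lt_of_lt_of_le (inv_pos.2 (hpos 0)) (hD' 0)
  refine ⟨D⁻¹, C, inv_pos.2 hDpos, lt_of_lt_of_le (hpos 0) (hC' 0), fun n => ⟨?_, ?_⟩⟩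
  · rw [← le_div_iff₀ (by positivity)]
    exact inv_le_of_inv_le₀ (hpos n) (hD' n)
  · rw [← div_le_iff₀ (by positivity)]
    exact hC' n

/-- Bound for the normalised Cesàro weights. -/
lemma cesWeight_bound {α β : ℝ} (hα : 0 < α) (hβα : β ≤ α) :
    ∃ C : ℝ, 0 < C ∧ ∀ n j : ℕ, j ≤ n → cesKernel α (n - j) / cesKernel (α + 1) n ≤
      C * ((((n - j : ℕ) : ℝ) + 1) ^ (β - 1) * ((n : ℝ) + 1) ^ (-β)) := by
  obtain ⟨c, C, hc, hC, h⟩ := cesKernel_bounds hα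
  refine ⟨C * max α 1 / c, by positivity, fun n j hj => ?_⟩
  have hi : n - j ≤ n := Nat.sub_le _ _
  generalize n - j = i at hi
  have hi' : (i : ℝ) ≤ n := by exact_mod_cast hi
  have k1 : α / (α + i) ≤ max α 1 * ((i : ℝ) + 1)⁻¹ := by
    rw [← div_eq_mul_inv, div_le_div_iff₀ (by positivity) (by positivity)]
    have hi0 : (0 : ℝ) ≤ i := by positivity
    rcases le_total α 1 with h1 | h1
    · rw [max_eq_right h1]; nlinarith
    · rw [max_eq_left h1]; nlinarith
  have k2 : cesKernel α i ≤ C * max α 1 * ((i : ℝ) + 1) ^ (α - 1) := by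
    rw [cesKernel_eq hα, Real.rpow_sub_one (by positivity)]
    calc _ ≤ (C * ((i : ℝ) + 1) ^ α) * (max α 1 * ((i : ℝ) + 1)⁻¹) := by
            gcongr
            exact (h i).2
      _ = _ := by ring
  have k3 : ((i : ℝ) + 1) ^ (α - 1) ≤ ((i : ℝ) + 1) ^ (β - 1) * ((n : ℝ) + 1) ^ (α - β) := by
    rw [show α - 1 = (β - 1) + (α - β) by ring, Real.rpow_add (by positivity)]
    have : 0 ≤ α - β := by linarith
    gcongr
  calc cesKernel α i / cesKernel (α + 1) n
      ≤ (C * max α 1 * (((i : ℝ) + 1) ^ (β - 1) * ((n : ℝ) + 1) ^ (α - β)))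
        / (c * ((n : ℝ) + 1) ^ α) := by
        gcongr
        · exact k2.trans (by gcongr)
        · exact (h n).1
    _ = _ := by
        rw [show -β = (α - β) - α by ring, Real.rpow_sub (by positivity) (α - β) α]
        field_simp

lemma sum_rpow_bound {δ : ℝ} (hδ : 0 < δ) (hδ1 : δ ≤ 1) (N : ℕ) :
    ∑ i ∈ Finset.range N, ((i : ℝ) + 1) ^ (δ - 1) ≤ (N : ℝ) ^ δ / δ := by
  induction N with
  | zero => simp [Real.zero_rpow hδ.ne']
  | succ N ih =>
    rw [Finset.sum_range_succ]
    have hN : (0 : ℝ) < (N : ℝ) + 1 := by positivity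
    have hb := rpow_one_add_le_one_add_mul_self (s := -((N : ℝ) + 1)⁻¹)
      (by
        have : ((N : ℝ) + 1)⁻¹ ≤ 1 := inv_le_one_of_one_le₀ (by simp)
        linarith) hδ.le hδ1
    have e : (N : ℝ) ^ δ = ((N : ℝ) + 1) ^ δ * (1 + -((N : ℝ) + 1)⁻¹) ^ δ := by
      have e1 : 1 + -((N : ℝ) + 1)⁻¹ = (N : ℝ) / (N + 1) := by field_simp; ring
      rw [e1, ← Real.mul_rpow hN.le (by positivity)]
      congr 1
      field_simp
    have h1 : (N : ℝ) ^ δ ≤ ((N : ℝ) + 1) ^ δ * (1 + δ * -((N : ℝ) + 1)⁻¹) := by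
      rw [e]; gcongr
    rw [le_div_iff₀ hδ] at ih ⊢
    push_cast
    rw [Real.rpow_sub_one hN.ne'] at *
    have : ((N : ℝ) + 1) ^ δ * (1 + δ * -((N : ℝ) + 1)⁻¹) =
      ((N : ℝ) + 1) ^ δ - δ * (((N : ℝ) + 1) ^ δ / ((N : ℝ) + 1)) := by ring
    rw [this] at h1
    linarith

lemma sum_rpow_refl {δ : ℝ} (hδ : 0 < δ) (hδ1 : δ ≤ 1) (L N : ℕ) (h : L ≤ N) :
    ∑ j ∈ Finset.range (L + 1), (((N - j : ℕ) : ℝ) + 1) ^ (δ - 1) ≤ ((N : ℝ) + 1) ^ δ / δ := by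
  calc _ ≤ ∑ j ∈ Finset.range (N + 1), (((N - j : ℕ) : ℝ) + 1) ^ (δ - 1) := by
        apply Finset.sum_le_sum_of_subset_of_nonneg
        · exact Finset.range_mono (by omega)
        · intros; positivity
    _ = ∑ j ∈ Finset.range (N + 1), ((j : ℝ) + 1) ^ (δ - 1) := by
        have h := Finset.sum_range_reflect (fun i : ℕ => ((i : ℝ) + 1) ^ (δ - 1)) (N + 1)
        simp only [Nat.add_sub_cancel] at h
        rw [← h]
    _ ≤ _ := by
        have := sum_rpow_bound hδ hδ1 (N + 1)
        push_cast at this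
        exact this

lemma rpow_mul_le {u v β ε : ℝ} (hu : 0 < u) (hv : 0 < v) (hβ : β ≤ 1) (hε : 0 ≤ ε) :
    u ^ (β - 1) * v ^ (-ε) ≤ u ^ (β - ε - 1) + v ^ (β - ε - 1) := by
  rcases le_total u v with h | h
  · have : v ^ (-ε) ≤ u ^ (-ε) := Real.rpow_le_rpow_of_nonpos hu h (by linarith)
    calc _ ≤ u ^ (β - 1) * u ^ (-ε) := by gcongr
      _ = u ^ (β - ε - 1) := by rw [← Real.rpow_add hu]; congr 1; ring
      _ ≤ _ := by linarith [Real.rpow_nonneg hv.le (β - ε - 1)]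
  · have : u ^ (β - 1) ≤ v ^ (β - 1) := Real.rpow_le_rpow_of_nonpos hv h (by linarith)
    calc _ ≤ v ^ (β - 1) * v ^ (-ε) := by gcongr
      _ = v ^ (β - ε - 1) := by rw [← Real.rpow_add hv]; congr 1; ring
      _ ≤ _ := by linarith [Real.rpow_nonneg hu.le (β - ε - 1)]

/-- The Schur-type column bound. -/
lemma schur_bound {α β ε : ℝ} (hα : 0 < α) (hβα : β ≤ α) (hβ1 : β ≤ 1) (hε : 0 < ε)
    (hεβ : ε < β) :
    ∃ K : ℝ, 0 < K ∧ ∀ n m L : ℕ, L ≤ n → L ≤ m →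
      ∑ j ∈ Finset.range (L + 1), cesKernel α (n - j) / cesKernel (α + 1) n *
        (((m : ℝ) + 1) ^ ε * (((m - j : ℕ) : ℝ) + 1) ^ (-ε)) ≤ K := by
  obtain ⟨C, hC, h⟩ := cesWeight_bound hα hβα
  set δ := β - ε with hδ
  have hδ0 : 0 < δ := by linarith
  have hδ1 : δ ≤ 1 := by linarith
  refine ⟨max (2 ^ ε) (C * 2 ^ ε * ((1 + 2 ^ δ) / δ)), by positivity, fun n m L hLn hLm => ?_⟩
  have hker : 0 < cesKernel (α + 1) n := cesKernel_pos (by positivity) n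
  rcases le_or_gt (2 * n) m with hm | hm
  · refine le_trans ?_ (le_max_left _ _)
    calc _ ≤ ∑ j ∈ Finset.range (L + 1), cesKernel α (n - j) / cesKernel (α + 1) n * 2 ^ ε := by
          apply Finset.sum_le_sum
          intro j hj
          have hj' : j ≤ n := by have := Finset.mem_range.1 hj; omega
          have := (cesKernel_pos hα (n - j)).le
          have hm2 : (m : ℝ) + 1 ≤ 2 * (((m - j : ℕ) : ℝ) + 1) := by
            have : m + 1 ≤ 2 * ((m - j) + 1) := by omega
            exact_mod_cast this
          gcongr
          rw [Real.rpow_neg (by positivity), ← div_eq_mul_inv, div_le_iff₀ (by positivity),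
            ← Real.mul_rpow (by positivity) (by positivity)]
          gcongr
      _ ≤ ∑ j ∈ Finset.range (n + 1), cesKernel α (n - j) / cesKernel (α + 1) n * 2 ^ ε := by
          apply Finset.sum_le_sum_of_subset_of_nonneg
          · exact Finset.range_mono (by omega)
          · intro j _ _
            have := (cesKernel_pos hα (n - j)).le
            positivity
      _ = 2 ^ ε := by
          rw [← Finset.sum_mul, ← Finset.sum_div, cesKernel_sum hα, div_self hker.ne', one_mul]
  · refine le_trans ?_ (le_max_right _ _)
    have hm2 : (m : ℝ) + 1 ≤ 2 * ((n : ℝ) + 1) := by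
      have : m + 1 ≤ 2 * (n + 1) := by omega
      exact_mod_cast this
    have hn0 : (0 : ℝ) < (n : ℝ) + 1 := by positivity
    calc _ ≤ ∑ j ∈ Finset.range (L + 1), C * 2 ^ ε * ((n : ℝ) + 1) ^ (-δ) *
            ((((n - j : ℕ) : ℝ) + 1) ^ (δ - 1) + (((m - j : ℕ) : ℝ) + 1) ^ (δ - 1)) := by
          apply Finset.sum_le_sum
          intro j hj
          have hj' : j ≤ n := by have := Finset.mem_range.1 hj; omega
          have k1 := rpow_mul_le (u := ((n - j : ℕ) : ℝ) + 1) (v := ((m - j : ℕ) : ℝ) + 1)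
            (by positivity) (by positivity) hβ1 hε.le
          have k2 : ((m : ℝ) + 1) ^ ε ≤ 2 ^ ε * ((n : ℝ) + 1) ^ ε := by
            rw [← Real.mul_rpow (by positivity) (by positivity)]
            gcongr
          calc _ ≤ (C * ((((n - j : ℕ) : ℝ) + 1) ^ (β - 1) * ((n : ℝ) + 1) ^ (-β))) *
                ((2 ^ ε * ((n : ℝ) + 1) ^ ε) * (((m - j : ℕ) : ℝ) + 1) ^ (-ε)) := by
                gcongr
                exact h n j hj'
            _ = C * 2 ^ ε * (((n : ℝ) + 1) ^ (-β) * ((n : ℝ) + 1) ^ ε) *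
                ((((n - j : ℕ) : ℝ) + 1) ^ (β - 1) * (((m - j : ℕ) : ℝ) + 1) ^ (-ε)) := by ring
            _ ≤ _ := by
                rw [← Real.rpow_add hn0, show -β + ε = -δ by rw [hδ]; ring]
                gcongr
      _ ≤ C * 2 ^ ε * ((n : ℝ) + 1) ^ (-δ) *
            (((n : ℝ) + 1) ^ δ / δ + (2 * ((n : ℝ) + 1)) ^ δ / δ) := by
          rw [← Finset.mul_sum, Finset.sum_add_distrib]
          gcongr
          · exact sum_rpow_refl hδ0 hδ1 L n hLn
          · refine (sum_rpow_refl hδ0 hδ1 L m hLm).trans ?_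
            gcongr
      _ = _ := by
          rw [Real.mul_rpow (by positivity) hn0.le, Real.rpow_neg hn0.le]
          have : ((n : ℝ) + 1) ^ δ ≠ 0 := by positivity
          field_simp

/-- The weight sequence `(k+1)^s`. -/
noncomputable def wt (s : ℝ) (k : ℕ) : ℝ := ((k : ℝ) + 1) ^ s

lemma wt_pos (s : ℝ) (k : ℕ) : 0 < wt s k := by unfold wt; positivity

/-- Existence of the weighted backward shift. -/
lemma exists_shift (p : ℝ≥0∞) [Fact (1 ≤ p)] (hp : p ≠ ⊤) (s : ℝ) (hs : 0 < s) :
    ∃ T : lp (fun _ : ℕ => ℂ) p →L[ℂ] lp (fun _ : ℕ => ℂ) p,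
      ∀ x k, T x k = ((wt s (k + 1) / wt s k : ℝ) : ℂ) * x (k + 1) := by
  have hP : 0 < p.toReal :=
    ENNReal.toReal_pos (by have := Fact.out (p := 1 ≤ p); positivity) hp
  have hw : ∀ k, wt s (k + 1) / wt s k ≤ 2 ^ s := by
    intro k
    rw [div_le_iff₀ (wt_pos s k)]
    unfold wt
    rw [← Real.mul_rpow (by positivity) (by positivity)]
    apply Real.rpow_le_rpow (by positivity) _ hs.le
    push_cast
    have : (0 : ℝ) ≤ k := by positivity
    linarith
  have key : ∀ (x : lp (fun _ : ℕ => ℂ) p) (S : Finset ℕ),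
      ∑ k ∈ S, ‖((wt s (k + 1) / wt s k : ℝ) : ℂ) * x (k + 1)‖ ^ p.toReal
        ≤ (2 ^ s * ‖x‖) ^ p.toReal := by
    intro x S
    calc _ ≤ ∑ k ∈ S, (2 ^ s) ^ p.toReal * ‖x (k + 1)‖ ^ p.toReal := by
          apply Finset.sum_le_sum
          intro k _
          rw [norm_mul, ← Real.mul_rpow (by positivity) (by positivity)]
          have : ‖((wt s (k + 1) / wt s k : ℝ) : ℂ)‖ ≤ 2 ^ s := by
            rw [Complex.norm_real, Real.norm_of_nonneg
              (div_pos (wt_pos s _) (wt_pos s _)).le]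
            exact hw k
          gcongr
      _ = (2 ^ s) ^ p.toReal * ∑ k ∈ S.map (addRightEmbedding 1), ‖x k‖ ^ p.toReal := by
          rw [← Finset.mul_sum, Finset.sum_map]
          rfl
      _ ≤ (2 ^ s) ^ p.toReal * ‖x‖ ^ p.toReal := by
          gcongr
          exact lp.sum_rpow_le_norm_rpow hP x _
      _ = _ := by rw [Real.mul_rpow (by positivity) (by positivity)]
  let L : lp (fun _ : ℕ => ℂ) p →ₗ[ℂ] lp (fun _ : ℕ => ℂ) p :=
    { toFun := fun x => ⟨fun k => ((wt s (k + 1) / wt s k : ℝ) : ℂ) * x (k + 1),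
        memℓp_gen' (key x)⟩
      map_add' := fun x y => by
        ext k
        change _ * ((x + y : lp (fun _ : ℕ => ℂ) p) (k + 1)) = _ * x (k + 1) + _ * y (k + 1)
        rw [lp.coeFn_add, Pi.add_apply, mul_add]
      map_smul' := fun c x => by
        ext k
        change _ * ((c • x : lp (fun _ : ℕ => ℂ) p) (k + 1)) = c * (_ * x (k + 1))
        rw [lp.coeFn_smul, Pi.smul_apply, smul_eq_mul]
        ring }
  refine ⟨L.mkContinuous (2 ^ s) (fun x => ?_), fun x k => rfl⟩
  exact lp.norm_le_of_forall_sum_le hP (by positivity) (key x)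

lemma shift_pow {p : ℝ≥0∞} [Fact (1 ≤ p)] {s : ℝ}
    {T : lp (fun _ : ℕ => ℂ) p →L[ℂ] lp (fun _ : ℕ => ℂ) p}
    (hT : ∀ x k, T x k = ((wt s (k + 1) / wt s k : ℝ) : ℂ) * x (k + 1)) (j : ℕ) :
    ∀ x k, (T ^ j) x k = ((wt s (k + j) / wt s k : ℝ) : ℂ) * x (k + j) := by
  induction j with
  | zero =>
    intro x k
    simp [div_self (wt_pos s k).ne']
  | succ j ih =>
    intro x k
    rw [pow_succ, ContinuousLinearMap.mul_apply, ih, hT, ← mul_assoc, ← Complex.ofReal_mul]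
    have h1 := (wt_pos s k).ne'
    have h2 := (wt_pos s (k + j)).ne'
    congr 2
    rw [add_assoc]
    field_simp

lemma reindex_sum (G : ℕ → ℕ → ℝ) (hG : ∀ j m, 0 ≤ G j m) (N n : ℕ) :
    ∑ k ∈ Finset.range N, ∑ j ∈ Finset.range (n + 1), G j (k + j) ≤
      ∑ m ∈ Finset.range (N + n), ∑ j ∈ Finset.range (min n m + 1), G j m := by
  rw [Finset.sum_sigma', Finset.sum_sigma']
  rw [← Finset.sum_image (s := (Finset.range N).sigma fun _ => Finset.range (n + 1))
    (g := fun q => (⟨q.1 + q.2, q.2⟩ : (_ : ℕ) × ℕ)) (f := fun q => G q.2 q.1)]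
  · apply Finset.sum_le_sum_of_subset_of_nonneg
    · intro q hq
      simp only [Finset.mem_image, Finset.mem_sigma, Finset.mem_range] at hq ⊢
      obtain ⟨⟨a, b⟩, ⟨h1, h2⟩, rfl⟩ := hq
      dsimp only at *
      omega
    · intros; exact hG _ _
  · rintro ⟨a, b⟩ _ ⟨c, d⟩ _ h
    simp only [Sigma.mk.injEq, heq_eq_eq] at h ⊢
    omega

lemma cesMean_apply {p : ℝ≥0∞} [Fact (1 ≤ p)] (α : ℝ)
    (T : lp (fun _ : ℕ => ℂ) p →L[ℂ] lp (fun _ : ℕ => ℂ) p) (n : ℕ)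
    (x : lp (fun _ : ℕ => ℂ) p) :
    cesMean α T n x = ∑ j ∈ Finset.range (n + 1),
      ((cesKernel α (n - j) / cesKernel (α + 1) n : ℝ) : ℂ) • (T ^ j) x := by
  unfold cesMean
  simp only [ContinuousLinearMap.smul_apply, ContinuousLinearMap.sum_apply, Finset.smul_sum,
    smul_smul, ← Complex.ofReal_mul]
  refine Finset.sum_congr rfl fun j _ => ?_
  rw [mul_comm, div_eq_mul_inv]

lemma cesMean_bound (p : ℝ≥0∞) [Fact (1 ≤ p)] (hp : p ≠ ⊤) {α β ε : ℝ} (hα : 0 < α)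
    (hβα : β ≤ α) (hβ1 : β ≤ 1) (hε : 0 < ε) (hεβ : ε < β)
    {T : lp (fun _ : ℕ => ℂ) p →L[ℂ] lp (fun _ : ℕ => ℂ) p}
    (hT : ∀ x k, T x k = ((wt (ε / p.toReal) (k + 1) / wt (ε / p.toReal) k : ℝ) : ℂ) * x (k + 1)) :
    ∃ K : ℝ, 0 < K ∧ ∀ n x, ‖cesMean α T n x‖ ≤ K * ‖x‖ := by
  have hP1 : 1 ≤ p.toReal := by
    have := ENNReal.toReal_mono hp (Fact.out (p := 1 ≤ p))
    simpa using this
  have hP : 0 < p.toReal := by linarith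
  obtain ⟨K, hK, hS⟩ := schur_bound hα hβα hβ1 hε hεβ
  have hw : ∀ m j : ℕ, (wt (ε / p.toReal) m / wt (ε / p.toReal) (m - j)) ^ p.toReal
      = ((m : ℝ) + 1) ^ ε * (((m - j : ℕ) : ℝ) + 1) ^ (-ε) := by
    intro m j
    rw [Real.div_rpow (wt_pos _ _).le (wt_pos _ _).le]
    unfold wt
    rw [← Real.rpow_mul (by positivity), ← Real.rpow_mul (by positivity),
      div_mul_cancel₀ _ hP.ne', Real.rpow_neg (by positivity), div_eq_mul_inv]
  refine ⟨K ^ (1 / p.toReal), by positivity, fun n x => ?_⟩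
  have hker : 0 < cesKernel (α + 1) n := cesKernel_pos (by positivity) n
  set a : ℕ → ℝ := fun j => cesKernel α (n - j) / cesKernel (α + 1) n with ha
  have ha0 : ∀ j, 0 ≤ a j := fun j => div_nonneg (cesKernel_pos hα _).le hker.le
  have ha1 : ∑ j ∈ Finset.range (n + 1), a j = 1 := by
    rw [ha, ← Finset.sum_div, cesKernel_sum hα, div_self hker.ne']
  set G : ℕ → ℕ → ℝ := fun j m => a j *
    ((wt (ε / p.toReal) m / wt (ε / p.toReal) (m - j)) ^ p.toReal * ‖x m‖ ^ p.toReal) with hG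
  have hG0 : ∀ j m, 0 ≤ G j m := fun j m => by
    have := ha0 j
    have := wt_pos (ε / p.toReal) m
    have := wt_pos (ε / p.toReal) (m - j)
    positivity
  have hcoord : ∀ k, ‖cesMean α T n x k‖ ^ p.toReal ≤ ∑ j ∈ Finset.range (n + 1), G j (k + j) := by
    intro k
    have h1 : ‖cesMean α T n x k‖ ≤ ∑ j ∈ Finset.range (n + 1),
        a j * ((wt (ε / p.toReal) (k + j) / wt (ε / p.toReal) k) * ‖x (k + j)‖) := by
      rw [cesMean_apply, lp.coeFn_sum, Finset.sum_apply]
      refine (norm_sum_le _ _).trans (Finset.sum_le_sum fun j _ => ?_)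
      rw [lp.coeFn_smul, Pi.smul_apply, shift_pow hT, norm_smul, norm_mul, Complex.norm_real,
        Complex.norm_real, Real.norm_of_nonneg (ha0 j), Real.norm_of_nonneg
              (div_pos (wt_pos _ _) (wt_pos _ _)).le]
    have hnn : ∀ j, 0 ≤ (wt (ε / p.toReal) (k + j) / wt (ε / p.toReal) k) * ‖x (k + j)‖ :=
      fun j => mul_nonneg (div_pos (wt_pos _ _) (wt_pos _ _)).le (norm_nonneg _)
    calc _ ≤ _ := Real.rpow_le_rpow (norm_nonneg _) h1 hP.le
      _ ≤ _ := Real.rpow_arith_mean_le_arith_mean_rpow _ _ _ (fun j _ => ha0 j) ha1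
            (fun j _ => hnn j) hP1
      _ = _ := by
          refine Finset.sum_congr rfl fun j _ => ?_
          rw [hG]
          simp only [Nat.add_sub_cancel]
          rw [Real.mul_rpow (div_pos (wt_pos _ _) (wt_pos _ _)).le (norm_nonneg _)]
  apply lp.norm_le_of_forall_sum_le hP (by positivity)
  intro S
  obtain ⟨N, hN⟩ := S.exists_nat_subset_range
  calc _ ≤ ∑ k ∈ Finset.range N, ‖cesMean α T n x k‖ ^ p.toReal :=
        Finset.sum_le_sum_of_subset_of_nonneg hN (fun _ _ _ => by positivity)
    _ ≤ ∑ k ∈ Finset.range N, ∑ j ∈ Finset.range (n + 1), G j (k + j) :=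
        Finset.sum_le_sum fun k _ => hcoord k
    _ ≤ _ := reindex_sum G hG0 N n
    _ ≤ ∑ m ∈ Finset.range (N + n), K * ‖x m‖ ^ p.toReal := by
        refine Finset.sum_le_sum fun m _ => ?_
        have := hS n m (min n m) (min_le_left _ _) (min_le_right _ _)
        simp only [hG, hw, ← mul_assoc]
        rw [← Finset.sum_mul]
        simp only [mul_assoc]
        gcongr
    _ ≤ K * ‖x‖ ^ p.toReal := by
        rw [← Finset.mul_sum]
        gcongr
        exact lp.sum_rpow_le_norm_rpow hP x _
    _ = _ := by
        rw [Real.mul_rpow (by positivity) (by positivity), ← Real.rpow_mul hK.le,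
          one_div_mul_cancel hP.ne', Real.rpow_one]

lemma exists_approx (p : ℝ≥0∞) [Fact (1 ≤ p)] (hp : p ≠ ⊤) (U : Set (lp (fun _ : ℕ => ℂ) p))
    (hU : IsOpen U) (x : lp (fun _ : ℕ => ℂ) p) (hx : x ∈ U) :
    ∃ S : Finset ℕ, ∑ i ∈ S, lp.single p i (x i) ∈ U :=
  ((lp.hasSum_single hp x).eventually (hU.mem_nhds hx)).exists

section
variable {p : ℝ≥0∞} [Fact (1 ≤ p)] {s : ℝ}
    {T : lp (fun _ : ℕ => ℂ) p →L[ℂ] lp (fun _ : ℕ => ℂ) p}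

lemma eventually_zero
    (hT : ∀ x k, T x k = ((wt s (k + 1) / wt s k : ℝ) : ℂ) * x (k + 1))
    (x : ℕ → ℂ) (S : Finset ℕ) :
    ∃ N : ℕ, ∀ n ≥ N, (T ^ n) (∑ i ∈ S, lp.single p i (x i)) = 0 := by
  obtain ⟨N, hN⟩ := S.exists_nat_subset_range
  refine ⟨N, fun n hn => ?_⟩
  rw [map_sum]
  refine Finset.sum_eq_zero fun i hi => ?_
  have hi' := Finset.mem_range.1 (hN hi)
  ext k
  rw [shift_pow hT, lp.single_apply_ne _ _ _ (by omega : k + n ≠ i)]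
  simp

lemma right_inv (hs : 0 < s)
    (hT : ∀ x k, T x k = ((wt s (k + 1) / wt s k : ℝ) : ℂ) * x (k + 1))
    (x : ℕ → ℂ) (S : Finset ℕ) :
    ∃ z : ℕ → lp (fun _ : ℕ => ℂ) p, Tendsto z atTop (nhds 0) ∧
      ∀ n, (T ^ n) (z n) = ∑ i ∈ S, lp.single p i (x i) := by
  refine ⟨fun n => ∑ i ∈ S, lp.single p (i + n) (((wt s i / wt s (i + n) : ℝ) : ℂ) * x i), ?_, ?_⟩
  · rw [← Finset.sum_const_zero (s := S)]
    refine tendsto_finsetSum _ fun i _ => ?_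
    rw [tendsto_zero_iff_norm_tendsto_zero]
    have hp0 : 0 < p := lt_of_lt_of_le one_pos (Fact.out (p := 1 ≤ p))
    simp only [lp.norm_single hp0, norm_mul, Complex.norm_real]
    rw [← zero_mul ‖x i‖]
    refine Tendsto.mul_const _ ?_
    rw [← norm_zero (E := ℝ)]
    refine Tendsto.norm ?_
    refine Tendsto.div_atTop tendsto_const_nhds ?_
    unfold wt
    refine (tendsto_rpow_atTop hs).comp ?_
    refine tendsto_atTop_add_const_right _ _ ?_
    refine tendsto_natCast_atTop_atTop.comp ?_
    exact tendsto_atTop_mono (fun n => Nat.le_add_left n i) tendsto_id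
  · intro n
    rw [map_sum]
    refine Finset.sum_congr rfl fun i _ => ?_
    ext k
    rw [shift_pow hT]
    by_cases h : k = i
    · subst h
      rw [lp.single_apply_self, lp.single_apply_self, ← mul_assoc, ← Complex.ofReal_mul]
      have h1 := (wt_pos s k).ne'
      have h2 := (wt_pos s (k + n)).ne'
      rw [show wt s (k + n) / wt s k * (wt s k / wt s (k + n)) = 1 by field_simp]
      simp
    · rw [lp.single_apply_ne _ _ _ h, lp.single_apply_ne _ _ _ (by omega : k + n ≠ i + n), mul_zero]

lemma shift_mixing (hp : p ≠ ⊤) (hs : 0 < s)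
    (hT : ∀ x k, T x k = ((wt s (k + 1) / wt s k : ℝ) : ℂ) * x (k + 1)) :
    TopologicallyMixing T := by
  rintro U V hU hV ⟨u, hu⟩ ⟨v, hv⟩
  obtain ⟨S, hS⟩ := exists_approx p hp U hU u hu
  obtain ⟨R, hR⟩ := exists_approx p hp V hV v hv
  obtain ⟨N, hN⟩ := eventually_zero hT (fun i => u i) S
  obtain ⟨z, hz, hz'⟩ := right_inv hs hT (fun i => v i) R
  have h := hz.const_add (∑ i ∈ S, lp.single p i (u i))
  rw [add_zero] at h
  obtain ⟨M, hM⟩ := eventually_atTop.1 (h.eventually (hU.mem_nhds hS))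
  refine ⟨max N M, fun n hn => ⟨_, ⟨_, hM n (le_trans (le_max_right _ _) hn), rfl⟩, ?_⟩⟩
  rw [map_add, hN n (le_trans (le_max_left _ _) hn), hz', zero_add]
  exact hR

lemma cesMean_tendsto_fin {α β : ℝ} (hα : 0 < α) (hβα : β ≤ α) (hβ1 : β ≤ 1) (hβ : 0 < β)
    (u : lp (fun _ : ℕ => ℂ) p) (hu : ∃ N : ℕ, ∀ n ≥ N, (T ^ n) u = 0) :
    Tendsto (fun n => cesMean α T n u) atTop (nhds 0) := by
  obtain ⟨C, hC, h⟩ := cesWeight_bound hα hβα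
  obtain ⟨N, hN⟩ := hu
  set B := ∑ j ∈ Finset.range N, ‖(T ^ j) u‖ with hB
  have hlim : Tendsto (fun n : ℕ => C * ((n : ℝ) + 1) ^ (-β) * B) atTop (nhds 0) := by
    have h1 : Tendsto (fun n : ℕ => ((n : ℝ) + 1) ^ (-β)) atTop (nhds 0) :=
      (tendsto_rpow_neg_atTop hβ).comp
        (tendsto_atTop_add_const_right _ _ tendsto_natCast_atTop_atTop)
    simpa using (h1.const_mul C).mul_const B
  refine squeeze_zero_norm (fun n => ?_) hlim
  have hker : 0 < cesKernel (α + 1) n := cesKernel_pos (by positivity) n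
  rw [cesMean_apply]
  calc _ ≤ ∑ j ∈ Finset.range (n + 1), C * ((n : ℝ) + 1) ^ (-β) * ‖(T ^ j) u‖ := by
        refine (norm_sum_le _ _).trans (Finset.sum_le_sum fun j hj => ?_)
        have hj' : j ≤ n := by have := Finset.mem_range.1 hj; omega
        rw [norm_smul, Complex.norm_real,
          Real.norm_of_nonneg (div_nonneg (cesKernel_pos hα _).le hker.le)]
        gcongr
        refine (h n j hj').trans ?_
        have : (((n - j : ℕ) : ℝ) + 1) ^ (β - 1) ≤ 1 :=
          Real.rpow_le_one_of_one_le_of_nonpos (by simp) (by linarith)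
        gcongr
        exact mul_le_of_le_one_left (by positivity) this
    _ = C * ((n : ℝ) + 1) ^ (-β) * ∑ j ∈ Finset.range (n + 1), ‖(T ^ j) u‖ := by
        rw [Finset.mul_sum]
    _ ≤ _ := by
        gcongr
        calc _ ≤ ∑ j ∈ Finset.range (max (n + 1) N), ‖(T ^ j) u‖ :=
              Finset.sum_le_sum_of_subset_of_nonneg (Finset.range_mono (le_max_left _ _))
                (fun _ _ _ => norm_nonneg _)
          _ = B := by
              symm
              refine Finset.sum_subset (Finset.range_mono (le_max_right _ _)) ?_
              intro j _ hj
              rw [hN j (by simpa using hj), norm_zero]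

end

/-- Let `α > 0` and `1 < p < ∞`. There exists a topologically mixing, `(C,α)`-mean ergodic
bounded linear operator on `ℓ^p(ℕ)`. -/
theorem stmt12 (p : ℝ≥0∞) [Fact (1 ≤ p)] (hp1 : 1 < p) (hp : p ≠ ⊤) (α : ℝ) (hα : 0 < α) :
    ∃ T : lp (fun _ : ℕ => ℂ) p →L[ℂ] lp (fun _ : ℕ => ℂ) p,
      TopologicallyMixing T ∧
      ∀ x : lp (fun _ : ℕ => ℂ) p, ∃ y : lp (fun _ : ℕ => ℂ) p,
        Tendsto (fun n : ℕ => (cesMean α T n) x) atTop (nhds y) := by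

  have hP1 : 1 ≤ p.toReal := by
    have := ENNReal.toReal_mono hp hp1.le
    simpa using this
  have hP : 0 < p.toReal := by linarith
  have hβ : 0 < min α 1 := lt_min hα one_pos
  have hs : 0 < min α 1 / 2 / p.toReal := by positivity
  obtain ⟨T, hT⟩ := exists_shift p hp _ hs
  refine ⟨T, shift_mixing hp hs hT, fun x => ⟨0, ?_⟩⟩
  obtain ⟨K, hK, hb⟩ := cesMean_bound p hp hα (min_le_left α 1) (min_le_right α 1)
    (half_pos hβ) (half_lt_self hβ) hT
  rw [Metric.tendsto_atTop]
  intro e he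
  obtain ⟨S, hS⟩ := exists_approx p hp (Metric.ball x (e / (2 * K))) Metric.isOpen_ball x
    (Metric.mem_ball_self (by positivity))
  set u := ∑ i ∈ S, lp.single p i (x i) with hu
  have hlim := cesMean_tendsto_fin (T := T) hα (min_le_left α 1) (min_le_right α 1) hβ u
    (eventually_zero hT (fun i => x i) S)
  obtain ⟨N, hN⟩ := Metric.tendsto_atTop.1 hlim (e / 2) (by positivity)
  refine ⟨N, fun n hn => ?_⟩
  have h1 := hN n hn
  rw [dist_zero_right] at h1 ⊢
  rw [Metric.mem_ball, dist_comm, dist_eq_norm] at hS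
  have h2 : ‖cesMean α T n (x - u)‖ < e / 2 := by
    calc _ ≤ K * ‖x - u‖ := hb n _
      _ < K * (e / (2 * K)) := by gcongr
      _ = e / 2 := by field_simp
  have h3 : cesMean α T n x = cesMean α T n (x - u) + cesMean α T n u := by
    rw [← map_add, sub_add_cancel]
  rw [h3]
  calc _ ≤ _ := norm_add_le _ _
    _ < e := by linarith
end

section
/- Let α ≥ 2 and let T be an absolutely (C,α)-Cesàro bounded operator on a complex Banach space X. Then ‖M_T^α(n+1) − M_T^α(n)‖ → 0 as n → ∞. -/
open Filter
open scoped ENNReal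

lemma ck_zero {a : ℝ} (ha : 0 < a) : cesKernel a 0 = 1 := by
  have := (Real.Gamma_pos_of_pos ha).ne'
  simp [cesKernel, this]

lemma ck_pos {a : ℝ} (ha : 0 < a) (n : ℕ) : 0 < cesKernel a n := by
  unfold cesKernel
  have h1 : 0 < Real.Gamma (a + n) := Real.Gamma_pos_of_pos (by positivity)
  have h2 : 0 < Real.Gamma a := Real.Gamma_pos_of_pos ha
  have h3 : 0 < Real.Gamma ((n : ℝ) + 1) := Real.Gamma_pos_of_pos (by positivity)
  positivity

lemma ck_succ {a : ℝ} (ha : 0 < a) (n : ℕ) :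
    cesKernel a (n + 1) = cesKernel a n * ((a + n) / (n + 1)) := by
  unfold cesKernel
  have h2 : 0 < Real.Gamma a := Real.Gamma_pos_of_pos ha
  have h3 : 0 < Real.Gamma ((n : ℝ) + 1) := Real.Gamma_pos_of_pos (by positivity)
  have e1 : Real.Gamma (a + (n + 1 : ℕ)) = (a + n) * Real.Gamma (a + n) := by
    rw [← Real.Gamma_add_one (by positivity)]
    push_cast
    ring_nf
  have e2 : Real.Gamma (((n + 1 : ℕ) : ℝ) + 1) = (n + 1) * Real.Gamma (n + 1) := by
    rw [← Real.Gamma_add_one (by positivity)]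
    push_cast
    ring_nf
  rw [e1, e2]
  have : (n : ℝ) + 1 ≠ 0 := by positivity
  field_simp

lemma ck_shift {a : ℝ} (ha : 0 < a) (n : ℕ) :
    cesKernel a n = a / (a + n) * cesKernel (a + 1) n := by
  unfold cesKernel
  have h2 : 0 < Real.Gamma a := Real.Gamma_pos_of_pos ha
  have h3 : 0 < Real.Gamma ((n : ℝ) + 1) := Real.Gamma_pos_of_pos (by positivity)
  have e1 : Real.Gamma (a + 1 + n) = (a + n) * Real.Gamma (a + n) := by
    rw [← Real.Gamma_add_one (by positivity)]
    ring_nf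
  have e2 : Real.Gamma (a + 1) = a * Real.Gamma a := Real.Gamma_add_one ha.ne'
  rw [e1, e2]
  have : a + n ≠ 0 := by positivity
  field_simp

lemma ck_diff {a : ℝ} (ha : 0 < a) (n : ℕ) :
    cesKernel (a + 1) (n + 1) - cesKernel (a + 1) n = cesKernel a (n + 1) := by
  rw [ck_succ ha, ck_shift ha n, ck_succ (by linarith)]
  have : a + n ≠ 0 := by positivity
  have : (n : ℝ) + 1 ≠ 0 := by positivity
  field_simp
  ring

lemma ck_mono {a : ℝ} (ha : 1 ≤ a) : Monotone (cesKernel a) := by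
  refine monotone_nat_of_le_succ fun n => ?_
  rw [ck_succ (by linarith)]
  refine le_mul_of_one_le_right (ck_pos (by linarith) n).le ?_
  rw [one_le_div (by positivity)]
  linarith

lemma ck_double {a : ℝ} (ha : 0 < a) (n : ℕ) :
    cesKernel (a + 1) (n + n) ≤ Real.exp a * cesKernel (a + 1) n := by
  have hK := ck_pos (show 0 < a + 1 by linarith)
  have key : ∀ i : ℕ, cesKernel (a + 1) (n + i) ≤
      Real.exp (a / (n + 1) * i) * cesKernel (a + 1) n := by
    intro i
    induction i with
    | zero => simp
    | succ i ih =>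
      rw [← add_assoc, ck_succ (by linarith)]
      have h1 : (a + 1 + ((n + i : ℕ) : ℝ)) / (((n + i : ℕ) : ℝ) + 1) ≤ Real.exp (a / (n + 1)) := by
        refine le_trans ?_ (Real.add_one_le_exp _)
        have : (a + 1 + ((n + i : ℕ) : ℝ)) / (((n + i : ℕ) : ℝ) + 1)
            = a / (((n + i : ℕ) : ℝ) + 1) + 1 := by
          have : ((n + i : ℕ) : ℝ) + 1 ≠ 0 := by positivity
          field_simp
          ring
        rw [this]
        push_cast
        gcongr
        linarith [(Nat.cast_nonneg i : (0:ℝ) ≤ i)]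
      calc _ ≤ (Real.exp (a / (n + 1) * i) * cesKernel (a + 1) n) * Real.exp (a / (n + 1)) :=
            mul_le_mul ih h1 (by positivity) (mul_pos (Real.exp_pos _) (hK n)).le
        _ = _ := by
          rw [mul_right_comm, ← Real.exp_add]
          push_cast
          ring_nf
  refine (key n).trans ?_
  refine mul_le_mul_of_nonneg_right (Real.exp_le_exp.2 ?_) (hK n).le
  rw [div_mul_eq_mul_div, div_le_iff₀ (by positivity)]
  nlinarith

lemma norm_sum_apply_le {X : Type*} [NormedAddCommGroup X] [NormedSpace ℂ X]
    (T : X →L[ℂ] X) (s : Finset ℕ) (f : ℕ → ℝ) (hf : ∀ j, 0 ≤ f j) (x : X) :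
    ‖(∑ j ∈ s, ((f j : ℝ) : ℂ) • T ^ j) x‖ ≤ ∑ j ∈ s, f j * ‖(T ^ j) x‖ := by
  rw [sum_apply]
  refine (norm_sum_le _ _).trans (Finset.sum_le_sum fun j _ => ?_)
  rw [smul_apply, norm_smul, Complex.norm_real, Real.norm_of_nonneg (hf j)]

lemma sum_diff {X : Type*} [NormedAddCommGroup X] [NormedSpace ℂ X]
    {a : ℝ} (ha : 0 < a) (T : X →L[ℂ] X) (n : ℕ) :
    ∑ j ∈ Finset.range (n + 1 + 1), ((cesKernel (a + 1) (n + 1 - j) : ℝ) : ℂ) • T ^ j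
      - ∑ j ∈ Finset.range (n + 1), ((cesKernel (a + 1) (n - j) : ℝ) : ℂ) • T ^ j
      = ∑ j ∈ Finset.range (n + 1 + 1), ((cesKernel a (n + 1 - j) : ℝ) : ℂ) • T ^ j := by
  rw [Finset.sum_range_succ, Finset.sum_range_succ _ (n + 1), add_sub_right_comm,
    ← Finset.sum_sub_distrib]
  congr 1
  · refine Finset.sum_congr rfl fun j hj => ?_
    have hj' : n + 1 - j = n - j + 1 := by
      have := Finset.mem_range.1 hj
      omega
    rw [← sub_smul, hj', ← ck_diff ha]
    push_cast
    rfl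
  · simp [ck_zero ha, ck_zero (show 0 < a + 1 by linarith)]

/-- Let `α ≥ 2` and `T` absolutely `(C,α)`-Cesàro bounded on a complex Banach space. Then
`‖M_T^α(n+1) - M_T^α(n)‖ → 0`. -/
theorem stmt17 {X : Type*} [NormedAddCommGroup X] [NormedSpace ℂ X] [CompleteSpace X]
    (α : ℝ) (hα : 2 ≤ α) (T : X →L[ℂ] X) (hT : AbsCesaroBounded α T) :
    Tendsto (fun n : ℕ => ‖cesMean α T (n + 1) - cesMean α T n‖) atTop (nhds 0) := by
  obtain ⟨C, hC, hb⟩ := hT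
  have hα0 : 0 < α := by linarith
  have hK := ck_pos (show 0 < α + 1 by linarith)
  have hk := ck_pos hα0
  have hl := ck_pos (show 0 < α - 1 by linarith)
  have hb' : ∀ (n : ℕ) (x : X), ∑ j ∈ Finset.range (n + 1), cesKernel α (n - j) * ‖(T ^ j) x‖
      ≤ cesKernel (α + 1) n * (C * ‖x‖) := by
    intro n x
    have := hb n x
    rwa [inv_mul_le_iff₀ (hK n)] at this
  -- the means are bounded
  have hM : ∀ n, ‖cesMean α T n‖ ≤ C := by
    intro n
    refine ContinuousLinearMap.opNorm_le_bound _ hC.le fun x => ?_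
    refine le_trans ?_ (hb n x)
    unfold cesMean
    rw [smul_apply, norm_smul, Complex.norm_real,
      Real.norm_of_nonneg (inv_nonneg.2 (hK n).le)]
    exact mul_le_mul_of_nonneg_left
      (norm_sum_apply_le T _ (fun j => cesKernel α (n - j)) (fun j => (hk _).le) x)
      (inv_nonneg.2 (hK n).le)
  -- bound of the lower order sums
  have hR : ∀ n : ℕ,
      ‖∑ j ∈ Finset.range (n + 1), ((cesKernel (α - 1) (n - j) : ℝ) : ℂ) • T ^ j‖
        ≤ (α - 1) / (α - 1 + n) * (Real.exp α * cesKernel (α + 1) n * C) := by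
    intro n
    have hq : 0 ≤ (α - 1) / (α - 1 + n) :=
      div_nonneg (by linarith) (by linarith [(Nat.cast_nonneg n : (0:ℝ) ≤ n)])
    refine ContinuousLinearMap.opNorm_le_bound _
      (mul_nonneg hq (mul_pos (mul_pos (Real.exp_pos _) (hK n)) hC).le) fun x => ?_
    calc _ ≤ ∑ j ∈ Finset.range (n + 1), cesKernel (α - 1) (n - j) * ‖(T ^ j) x‖ :=
          norm_sum_apply_le T _ (fun j => cesKernel (α - 1) (n - j)) (fun j => (hl _).le) x
      _ ≤ ∑ j ∈ Finset.range (n + 1),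
            (α - 1) / (α - 1 + n) * (cesKernel α (n + n - j) * ‖(T ^ j) x‖) := by
          refine Finset.sum_le_sum fun j hj => ?_
          rw [← mul_assoc]
          refine mul_le_mul_of_nonneg_right ?_ (norm_nonneg _)
          have h1 : cesKernel (α - 1) (n - j) ≤ cesKernel (α - 1) n :=
            ck_mono (by linarith) (Nat.sub_le _ _)
          refine h1.trans ?_
          rw [ck_shift (by linarith), sub_add_cancel]
          refine mul_le_mul_of_nonneg_left (ck_mono (by linarith) ?_) hq
          have := Finset.mem_range.1 hj
          omega
      _ ≤ (α - 1) / (α - 1 + n) *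
            ∑ j ∈ Finset.range (n + n + 1), cesKernel α (n + n - j) * ‖(T ^ j) x‖ := by
          rw [← Finset.mul_sum]
          refine mul_le_mul_of_nonneg_left ?_ hq
          refine Finset.sum_le_sum_of_subset_of_nonneg ?_
            fun j _ _ => mul_nonneg (hk _).le (norm_nonneg _)
          exact Finset.range_mono (by omega)
      _ ≤ (α - 1) / (α - 1 + n) * (cesKernel (α + 1) (n + n) * (C * ‖x‖)) :=
          mul_le_mul_of_nonneg_left (hb' _ x) hq
      _ ≤ (α - 1) / (α - 1 + n) * (Real.exp α * cesKernel (α + 1) n * (C * ‖x‖)) := by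
          refine mul_le_mul_of_nonneg_left ?_ hq
          exact mul_le_mul_of_nonneg_right (ck_double hα0 n) (by positivity)
      _ = _ := by ring
  -- the decomposition
  have hdec : ∀ n : ℕ, cesMean α T (n + 1) - cesMean α T n =
      (((cesKernel (α + 1) (n + 1))⁻¹ : ℝ) : ℂ) •
        (∑ j ∈ Finset.range (n + 1 + 1), ((cesKernel (α - 1) (n + 1 - j) : ℝ) : ℂ) • T ^ j)
      - ((α / (α + (n + 1 : ℕ)) : ℝ) : ℂ) • cesMean α T n := by
    intro n
    have h := sum_diff (show 0 < α - 1 by linarith) T n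
    rw [sub_add_cancel] at h
    rw [← h]
    unfold cesMean
    rw [smul_sub, smul_smul, sub_sub, ← add_smul]
    congr 2
    have h1 := ck_diff hα0 n
    rw [ck_shift hα0] at h1
    have hr : (cesKernel (α + 1) n)⁻¹ = (cesKernel (α + 1) (n + 1))⁻¹ +
        α / (α + (n + 1 : ℕ)) * (cesKernel (α + 1) n)⁻¹ := by
      have a1 := (hK n).ne'
      have a2 := (hK (n + 1)).ne'
      generalize α / (α + (n + 1 : ℕ)) = q at *
      field_simp
      linarith
    exact_mod_cast hr
  have hfin : ∀ n : ℕ, ‖cesMean α T (n + 1) - cesMean α T n‖ ≤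
      ((α - 1) * (Real.exp α * C) + α * C) * (1 / ((n : ℝ) + 1)) := by
    intro n
    rw [hdec]
    refine (norm_sub_le _ _).trans ?_
    rw [norm_smul, norm_smul, Complex.norm_real, Complex.norm_real,
      Real.norm_of_nonneg (inv_nonneg.2 (hK _).le), Real.norm_of_nonneg (by positivity), add_mul]
    have hn : (0:ℝ) ≤ n := Nat.cast_nonneg n
    refine add_le_add ?_ ?_
    · rw [inv_mul_le_iff₀ (hK _)]
      refine (hR (n + 1)).trans ?_
      have h2 : (α - 1) / (α - 1 + ((n + 1 : ℕ) : ℝ)) ≤ (α - 1) * (1 / ((n : ℝ) + 1)) := by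
        rw [mul_one_div]
        push_cast
        exact div_le_div_of_nonneg_left (by linarith) (by positivity) (by linarith)
      refine (mul_le_mul_of_nonneg_right h2
        (mul_pos (mul_pos (Real.exp_pos _) (hK _)) hC).le).trans (le_of_eq ?_)
      ring
    · have h2 : α / (α + ((n + 1 : ℕ) : ℝ)) ≤ α * (1 / ((n : ℝ) + 1)) := by
        rw [mul_one_div]
        push_cast
        exact div_le_div_of_nonneg_left (by linarith) (by positivity) (by linarith)
      refine (mul_le_mul h2 (hM n) (norm_nonneg _) (by positivity)).trans (le_of_eq ?_)
      ring
  refine squeeze_zero (fun n => norm_nonneg _) hfin ?_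
  simpa using (tendsto_one_div_add_atTop_nhds_zero_nat (𝕜 := ℝ)).const_mul
    ((α - 1) * (Real.exp α * C) + α * C)
end
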